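/- Let b₁, b₂ : [0,1] → ℝ⁴ be maps whose coordinate functions are real polynomials in t, and suppose that for every t ∈ [0,1] the 4×4 matrix with rows b₁(t), b₂(t), b₁′(t), b₂′(t) is invertible. Then there exist constants C > 0 and c > 0 such that for every t ∈ [0,1], every δ > 0, and every z ∈ ℝ⁴: if |(b₁(t)·z, b₂(t)·z)| ≤ 2δ and |z| ≥ Cδ, then |(b₁′(t)·z, b₂′(t)·z)| ≥ c|z|. -/

import Mathlib

open MeasureTheory Set

/-- The Euclidean norm of a vector in `Fin k → ℝ`. -/
noncomputable def euclNorm {k : ℕ} (y : Fin k → ℝ) : ℝ :=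
  Real.sqrt (∑ i, (y i) ^ 2)

/-- The Euclidean dot product on `Fin 4 → ℝ`. -/
noncomputable def dot4 (x y : Fin 4 → ℝ) : ℝ := ∑ i, x i * y i

/-- A continuous family of invertible matrices over a compact set is uniformly bounded below. -/
theorem exists_pos_forall_sq_mul_sum_sq_le_sum_mulVec_sq {X n : Type*} [TopologicalSpace X]
    [Fintype n] [DecidableEq n] {S : Set X} (hS : IsCompact S) {M : X → Matrix n n ℝ}
    (hM : Continuous M) (hdet : ∀ x ∈ S, (M x).det ≠ 0) :
    ∃ k : ℝ, 0 < k ∧ ∀ x ∈ S, ∀ z : n → ℝ,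
      k ^ 2 * ∑ i, z i ^ 2 ≤ ∑ i, (M x).mulVec z i ^ 2 := by
  have hcompact : IsCompact {z : n → ℝ | ∑ i, z i ^ 2 = 1} := by
    refine (isCompact_Icc (a := fun _ : n => (-1 : ℝ)) (b := fun _ => 1)).of_isClosed_subset
      (isClosed_eq (by fun_prop) continuous_const) fun z hz => ?_
    have hle : ∀ i, z i ^ 2 ≤ 1 := fun i => by
      rw [← show ∑ i, z i ^ 2 = 1 from hz]
      exact Finset.single_le_sum (f := fun i => z i ^ 2) (fun _ _ => sq_nonneg _)
        (Finset.mem_univ i)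
    exact ⟨fun i => (abs_le.1 (sq_le_one_iff_abs_le_one _ |>.1 (hle i))).1,
      fun i => (abs_le.1 (sq_le_one_iff_abs_le_one _ |>.1 (hle i))).2⟩
  have hcont : Continuous fun p : X × (n → ℝ) => ∑ i, (M p.1).mulVec p.2 i ^ 2 := by
    have : Continuous fun p : X × (n → ℝ) => (M p.1).mulVec p.2 :=
      (hM.comp continuous_fst).matrix_mulVec continuous_snd
    fun_prop
  have hpos : ∀ p ∈ S ×ˢ {z : n → ℝ | ∑ i, z i ^ 2 = 1},
      0 < ∑ i, (M p.1).mulVec p.2 i ^ 2 := by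
    rintro ⟨x, z⟩ ⟨hx, hz⟩
    refine (Finset.sum_nonneg fun _ _ => sq_nonneg _).lt_of_ne fun h => ?_
    have hzero : (M x).mulVec z = 0 := by
      ext i
      have := (Finset.sum_eq_zero_iff_of_nonneg fun _ _ => sq_nonneg _).1 h.symm i
        (Finset.mem_univ i)
      simpa using this
    have hz0 := Matrix.eq_zero_of_mulVec_eq_zero (hdet x hx) hzero
    simp [hz0] at hz
  obtain ⟨m, hm, hmle⟩ := (hS.prod hcompact).exists_forall_le' hcont.continuousOn hpos
  refine ⟨√m, Real.sqrt_pos.2 hm, fun x hx z => ?_⟩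
  rw [Real.sq_sqrt hm.le]
  obtain hz | hz := (Finset.sum_nonneg fun i (_ : i ∈ Finset.univ) => sq_nonneg (z i)).eq_or_lt
  · rw [← hz, mul_zero]
    exact Finset.sum_nonneg fun _ _ => sq_nonneg _
  · have hr := Real.sq_sqrt hz.le
    have hunit : ∑ i, ((√(∑ i, z i ^ 2))⁻¹ • z) i ^ 2 = 1 := by
      simp only [Pi.smul_apply, smul_eq_mul, mul_pow, ← Finset.mul_sum, inv_pow, hr]
      exact inv_mul_cancel₀ hz.ne'
    have h := hmle (x, (√(∑ i, z i ^ 2))⁻¹ • z) ⟨hx, hunit⟩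
    simp only [Matrix.mulVec_smul, Pi.smul_apply, smul_eq_mul, mul_pow, ← Finset.mul_sum,
      inv_pow, hr] at h
    rwa [inv_mul_eq_div, le_div_iff₀ hz] at h

theorem continuous_and_continuous_deriv_of_eq_eval {f : ℝ → ℝ}
    (hf : ∃ p : Polynomial ℝ, ∀ t, f t = p.eval t) :
    Continuous f ∧ Continuous (deriv f) := by
  obtain ⟨p, hp⟩ := hf
  obtain rfl : f = fun t => p.eval t := funext hp
  refine ⟨p.continuous, ?_⟩
  rw [show deriv (fun t => p.eval t) = fun t => p.derivative.eval t from
    funext fun t => p.deriv]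
  exact p.derivative.continuous

/-- **Transversality estimate.**  Let `b₁, b₂ : [0,1] → ℝ⁴` have polynomial
coordinate functions and suppose the `4 × 4` matrix with rows
`b₁(t), b₂(t), b₁′(t), b₂′(t)` is invertible for every `t ∈ [0,1]`.  Then there
are constants `C > 0` and `c > 0` such that for every `t ∈ [0,1]`, `δ > 0` and
`z ∈ ℝ⁴`: if `|(b₁(t)·z, b₂(t)·z)| ≤ 2δ` and `|z| ≥ Cδ`, then
`|(b₁′(t)·z, b₂′(t)·z)| ≥ c|z|`. -/
theorem statement14
    (b₁ b₂ : ℝ → (Fin 4 → ℝ))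
    (hb₁ : ∀ i, ∃ p : Polynomial ℝ, ∀ t, b₁ t i = p.eval t)
    (hb₂ : ∀ i, ∃ p : Polynomial ℝ, ∀ t, b₂ t i = p.eval t)
    (hinv : ∀ t ∈ Icc (0:ℝ) 1,
      ((Matrix.of ![b₁ t, b₂ t,
          fun i => deriv (fun s => b₁ s i) t,
          fun i => deriv (fun s => b₂ s i) t]) :
        Matrix (Fin 4) (Fin 4) ℝ).det ≠ 0) :
    ∃ C : ℝ, 0 < C ∧ ∃ c : ℝ, 0 < c ∧
      ∀ t ∈ Icc (0:ℝ) 1, ∀ δ : ℝ, 0 < δ → ∀ z : Fin 4 → ℝ,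
        Real.sqrt ((dot4 (b₁ t) z) ^ 2 + (dot4 (b₂ t) z) ^ 2) ≤ 2 * δ →
        C * δ ≤ euclNorm z →
        c * euclNorm z ≤
          Real.sqrt ((dot4 (fun i => deriv (fun s => b₁ s i) t) z) ^ 2 +
            (dot4 (fun i => deriv (fun s => b₂ s i) t) z) ^ 2) := by
  have hcont : Continuous fun t => (Matrix.of ![b₁ t, b₂ t,
      fun i => deriv (fun s => b₁ s i) t,
      fun i => deriv (fun s => b₂ s i) t] : Matrix (Fin 4) (Fin 4) ℝ) := by
    refine continuous_matrix fun i j => ?_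
    have h₁ := continuous_and_continuous_deriv_of_eq_eval (hb₁ j)
    have h₂ := continuous_and_continuous_deriv_of_eq_eval (hb₂ j)
    fin_cases i
    exacts [h₁.1, h₂.1, h₁.2, h₂.2]
  obtain ⟨k, hk, hbound⟩ :=
    exists_pos_forall_sq_mul_sum_sq_le_sum_mulVec_sq isCompact_Icc hcont hinv
  refine ⟨4 / k, by positivity, k / 2, by positivity, fun t ht δ hδ z hsmall hlarge => ?_⟩
  have h := hbound t ht z
  have hN : euclNorm z ^ 2 = ∑ i, z i ^ 2 :=
    Real.sq_sqrt (Finset.sum_nonneg fun _ _ => sq_nonneg _)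
  rw [← hN, Fin.sum_univ_four] at h
  change k ^ 2 * euclNorm z ^ 2 ≤ dot4 (b₁ t) z ^ 2 + dot4 (b₂ t) z ^ 2 +
    dot4 (fun i => deriv (fun s => b₁ s i) t) z ^ 2 +
    dot4 (fun i => deriv (fun s => b₂ s i) t) z ^ 2 at h
  have hδN : 4 * δ ≤ k * euclNorm z := by
    rwa [div_mul_eq_mul_div, div_le_iff₀ hk, mul_comm (euclNorm z)] at hlarge
  have hsq := (Real.sqrt_le_left (by positivity)).1 hsmall
  apply Real.le_sqrt_of_sq_le
  nlinarith [mul_self_le_mul_self (by positivity) hδN]
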